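/- Let η ≥ 1 and δ = (δ_1,…,δ_d) ∈ ℕ^d. Define Ā_2(η,δ) = η + 4|δ| + 1 and, for d ≥ 3, Ā_d(η,δ) = |δ| − 1 + d↑^{d²−d−1}(3^{η+3|δ|}). Then for every d ≥ 2, if V = ⊕_{i=1}^d V_i is a graded vector space of forms in R with dimension vector δ such that str(V_j) ≥ Ā_d(η,δ) for every 1 ≤ j ≤ d with V_j ≠ 0, then every homogeneous K-basis of V is an R_η-sequence. -/

import Mathlib

open MvPolynomial

/-- Knuth's up-arrow `knuth a k b = a ↑^k b`, with `a ↑^1 b = a ^ b`,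
`a ↑^(k+1) 1 = a` and `a ↑^(k+1) (b+1) = a ↑^k (a ↑^(k+1) b)`. -/
def knuth (a : ℕ) : ℕ → ℕ → ℕ
  | 0, b => a ^ b
  | 1, b => a ^ b
  | _+2, 0 => 1
  | _+2, 1 => a
  | k+2, b+2 => knuth a (k+1) (knuth a (k+2) (b+1))
  termination_by k b => (k, b)

/-- A (Noetherian) local ring is regular iff its maximal ideal can be generated by
`ringKrullDim` many elements. -/
def IsRegularLocal (S : Type*) [CommRing S] : Prop :=
  IsNoetherianRing S ∧ IsLocalRing S ∧
    ∃ s : Finset S, (Ideal.span (s : Set S)).IsMaximal ∧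
      (s.card : WithBot (WithTop ℕ)) = ringKrullDim S

/-- Serre's condition `R_η`: the localization at every prime of height at most `η`
is a regular local ring. -/
def SerreReg (η : ℕ) (S : Type*) [CommRing S] : Prop :=
  ∀ p : PrimeSpectrum S, Order.height p ≤ (η : ℕ∞) →
    IsRegularLocal (Localization.AtPrime p.asIdeal)

/-- `y` is an `R_η`-sequence: it generates a proper ideal and the quotient by each
initial segment satisfies Serre's condition `R_η`. -/
def IsSerreSeq (η : ℕ) {S : Type*} [CommRing S] {n : ℕ} (y : Fin n → S) : Prop :=
  Ideal.span (Set.range y) ≠ ⊤ ∧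
    ∀ m : ℕ, m ≤ n →
      SerreReg η (S ⧸ Ideal.span (y '' {j : Fin n | (j : ℕ) < m}))

/-- `F` has a `k`-collapse: `F = Σ_{i=1}^k f_i g_i` with all `f_i, g_i`
homogeneous of positive degree.  The strength of `F` is `≥ k` iff `F` has no
`k`-collapse. -/
def HasCollapse {K : Type*} [CommSemiring K] {N : ℕ} (k : ℕ)
    (F : MvPolynomial (Fin N) K) : Prop :=
  ∃ f g : Fin k → MvPolynomial (Fin N) K,
    (∀ i, ∃ d > 0, (f i).IsHomogeneous d) ∧
    (∀ i, ∃ d > 0, (g i).IsHomogeneous d) ∧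
    F = ∑ i, f i * g i

open IsLocalRing

lemma MvPolynomial.aeval_add_sub_mem {σ K A : Type*} [Fintype σ] [CommRing K] [CommRing A]
    [Algebra K A] (I : Ideal A) (a δ : σ → A) (hδ : ∀ u, δ u ∈ I) (g : MvPolynomial σ K) :
    aeval (a + δ) g - aeval a g - ∑ u, aeval a (pderiv u g) * δ u ∈ I ^ 2 := by
  classical
  induction g using MvPolynomial.induction_on with
  | C r => simp
  | add p q hp hq =>
    convert (I ^ 2).add_mem hp hq using 1
    simp only [map_add, add_mul, Finset.sum_add_distrib]
    ring
  | mul_X p i hp =>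
    have hs : ∑ u, aeval a (pderiv u p) * δ u ∈ I :=
      Ideal.sum_mem _ fun u _ => Ideal.mul_mem_left _ _ (hδ u)
    have h2 : (∑ u, aeval a (pderiv u p) * δ u) * δ i ∈ I ^ 2 := by
      rw [pow_two]
      exact Ideal.mul_mem_mul hs (hδ i)
    convert (I ^ 2).add_mem (Ideal.mul_mem_right (a i + δ i) _ hp) h2 using 1
    have : ∑ u, aeval a (pderiv u (p * X i)) * δ u =
        (∑ u, aeval a (pderiv u p) * δ u) * a i + aeval a p * δ i := by
      simp only [Derivation.leibniz, pderiv_X, smul_eq_mul, map_add, map_mul, aeval_X, add_mul,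
        Finset.sum_add_distrib, Finset.sum_mul]
      rw [add_comm]
      congr 1
      · exact Finset.sum_congr rfl fun u _ => by ring
      · rw [Finset.sum_eq_single i] <;> simp +contextual [eq_comm]
    rw [this]
    simp only [map_mul, aeval_X, Pi.add_apply]
    ring

lemma MvPolynomial.aeval_mem_ker_sq_of_pderiv {K σ A κ : Type*} [Field K] [Fintype σ]
    [CommRing A] [Algebra K A] [CommRing κ] [Algebra K κ] [Algebra.FormallySmooth K κ]
    (p : A →ₐ[K] κ) (hp : Function.Surjective p) (x : σ → A) {g : MvPolynomial σ K}
    (hg : p (aeval x g) = 0) (hd : ∀ u, p (aeval x (pderiv u g)) = 0) :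
    aeval x g ∈ RingHom.ker p ^ 2 := by
  let m := RingHom.ker p
  let π : (A ⧸ m ^ 2) →ₐ[K] κ := Ideal.Quotient.liftₐ (m ^ 2) p
    fun a ha => Ideal.pow_le_self two_ne_zero ha
  have hπ (a : A) : π (Ideal.Quotient.mk _ a) = p a := rfl
  have hI : (RingHom.ker (π : (A ⧸ m ^ 2) →+* κ)) ^ 2 = ⊥ := by
    have hIm : RingHom.ker (π : (A ⧸ m ^ 2) →+* κ) ≤ m.map (Ideal.Quotient.mk (m ^ 2)) := by
      intro y hy
      obtain ⟨a, rfl⟩ := Ideal.Quotient.mk_surjective y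
      exact Ideal.mem_map_of_mem _ hy
    rw [eq_bot_iff]
    refine (Ideal.pow_right_mono hIm 2).trans ?_
    have := Ideal.map_pow (Ideal.Quotient.mk (m ^ 2)) m 2
    rw [← this, Ideal.map_quotient_self]
  have hsurj : Function.Surjective π := fun y => by
    obtain ⟨a, rfl⟩ := hp y
    exact ⟨Ideal.Quotient.mk _ a, rfl⟩
  let s := Algebra.FormallySmooth.liftOfSurjective (AlgHom.id K κ) π hsurj ⟨2, hI⟩
  have hs (y) : π (s y) = y := Algebra.FormallySmooth.liftOfSurjective_apply _ _ hsurj ⟨2, hI⟩ y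
  let x' : σ → A ⧸ m ^ 2 := fun u => Ideal.Quotient.mk _ (x u)
  have hx (f : MvPolynomial σ K) : aeval x' f = Ideal.Quotient.mk (m ^ 2) (aeval x f) := by
    have : aeval x' = (Ideal.Quotient.mkₐ K (m ^ 2)).comp (aeval x) :=
      MvPolynomial.algHom_ext fun u => by simp [x']
    rw [this]; rfl
  have hsξ (f : MvPolynomial σ K) :
      aeval (fun u => s (p (x u))) f = s (p (aeval x f)) := by
    have : aeval (fun u => s (p (x u))) = (s.comp p).comp (aeval x) :=
      MvPolynomial.algHom_ext fun u => by simp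
    rw [this]; rfl
  have hT := aeval_add_sub_mem (RingHom.ker (π : (A ⧸ m ^ 2) →+* κ)) (fun u => s (p (x u)))
    (fun u => x' u - s (p (x u))) (fun u => by
      change π _ = 0
      rw [map_sub, hs]
      exact sub_self _) g
  have hadd : (fun u => s (p (x u))) + (fun u => x' u - s (p (x u))) = x' := by ext u; simp
  rw [hadd, hsξ, hg, hI, Finset.sum_eq_zero fun u _ => by rw [hsξ, hd u, map_zero, zero_mul],
    hx] at hT
  simp only [sub_zero, map_zero, Ideal.mem_bot] at hT
  exact Ideal.Quotient.eq_zero_iff_mem.mp hT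

lemma MvPolynomial.algebraMap_mem_maximalIdeal_sq {K σ : Type*} [Field K]
    [PerfectField K] [Fintype σ] (P : Ideal (MvPolynomial σ K)) [P.IsPrime]
    {g : MvPolynomial σ K} (hg : g ∈ P) (hd : ∀ u, pderiv u g ∈ P) :
    algebraMap _ (Localization.AtPrime P) g ∈ maximalIdeal (Localization.AtPrime P) ^ 2 := by
  have : Algebra.EssFiniteType (MvPolynomial σ K) (Localization.AtPrime P) :=
    Algebra.EssFiniteType.of_isLocalization _ P.primeCompl
  have : Algebra.EssFiniteType K (Localization.AtPrime P) :=
    Algebra.EssFiniteType.comp K (MvPolynomial σ K) _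
  have : Algebra.EssFiniteType K P.ResidueField :=
    Algebra.EssFiniteType.comp K (Localization.AtPrime P) _
  have : Algebra.FormallySmooth K P.ResidueField := inferInstance
  let p := IsScalarTower.toAlgHom K (Localization.AtPrime P) P.ResidueField
  have hp : RingHom.ker p = maximalIdeal (Localization.AtPrime P) :=
    IsLocalRing.ker_residue
  let x : σ → Localization.AtPrime P := fun u => algebraMap _ _ (X u : MvPolynomial σ K)
  have hx (f : MvPolynomial σ K) : aeval x f = algebraMap _ _ f := by
    have : aeval x = IsScalarTower.toAlgHom K (MvPolynomial σ K) (Localization.AtPrime P) :=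
      MvPolynomial.algHom_ext fun u => by simp [x]
    rw [this]; rfl
  have h0 (f) (hf : f ∈ P) : p (aeval x f) = 0 := by
    rw [hx]
    exact Ideal.algebraMap_residueField_eq_zero.mpr hf
  rw [← hp, ← hx]
  exact aeval_mem_ker_sq_of_pderiv p IsLocalRing.residue_surjective x (h0 g hg)
    fun u => h0 _ (hd u)

/-- A family in a ring is independent at a prime `P` if no `R`-linear combination with a
coefficient outside `P` lies in the square of the maximal ideal of the localization at `P`. -/
def IndepAt {R ι : Type*} [CommRing R] [Fintype ι] (P : Ideal R) [P.IsPrime] (y : ι → R) : Prop :=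
  ∀ c : ι → R, algebraMap R (Localization.AtPrime P) (∑ j, c j * y j) ∈
    maximalIdeal (Localization.AtPrime P) ^ 2 → ∀ j, c j ∈ P

lemma algebraMap_mem_maximalIdeal {R : Type*} [CommRing R] {P : Ideal R} [P.IsPrime] {g : R}
    (hg : g ∈ P) : algebraMap R (Localization.AtPrime P) g ∈
      maximalIdeal (Localization.AtPrime P) :=
  (IsLocalization.AtPrime.to_map_mem_maximal_iff _ P g).mpr hg

lemma indepAt_iff {R ι : Type*} [CommRing R] [Fintype ι] (P : Ideal R) [P.IsPrime]
    (y : ι → R) (hy : ∀ j, y j ∈ P) :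
    IndepAt P y ↔ LinearIndependent P.ResidueField (fun j =>
      (maximalIdeal (Localization.AtPrime P)).toCotangent
        ⟨algebraMap R _ (y j), algebraMap_mem_maximalIdeal (hy j)⟩) := by
  classical
  have key (c : ι → Localization.AtPrime P) :
      ∑ j, residue _ (c j) • (maximalIdeal (Localization.AtPrime P)).toCotangent
        ⟨algebraMap R _ (y j), algebraMap_mem_maximalIdeal (hy j)⟩ = 0 ↔
      ∑ j, c j * algebraMap R _ (y j) ∈ maximalIdeal (Localization.AtPrime P) ^ 2 := by
    have : ∑ j, residue _ (c j) • (maximalIdeal (Localization.AtPrime P)).toCotangent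
        ⟨algebraMap R _ (y j), algebraMap_mem_maximalIdeal (hy j)⟩ =
        (maximalIdeal (Localization.AtPrime P)).toCotangent
        (∑ j, c j • ⟨algebraMap R _ (y j), algebraMap_mem_maximalIdeal (hy j)⟩) := by
      rw [map_sum]
      refine Finset.sum_congr rfl fun j _ => ?_
      rw [map_smul]
      rfl
    rw [this, Ideal.toCotangent_eq_zero]
    simp
  rw [Fintype.linearIndependent_iff]
  constructor
  · intro h g hg j
    choose a ha using fun j => IsLocalRing.residue_surjective (g j)
    obtain ⟨s, hs⟩ := IsLocalization.exist_integer_multiples P.primeCompl Finset.univ a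
    choose r hr using fun j => hs j (Finset.mem_univ j)
    rw [← ha j, IsLocalRing.residue_eq_zero_iff]
    have h1 := (key a).mp (by simpa [ha] using hg)
    have h2 := h r (by
      rw [map_sum]
      convert Ideal.mul_mem_left _ (algebraMap R _ (s : R)) h1 using 1
      rw [Finset.mul_sum]
      refine Finset.sum_congr rfl fun j _ => ?_
      rw [map_mul, hr, Algebra.smul_def, mul_assoc]) j
    have h3 : algebraMap R (Localization.AtPrime P) s * a j ∈ maximalIdeal _ := by
      rw [← Algebra.smul_def, ← hr]
      exact algebraMap_mem_maximalIdeal h2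
    refine ((maximalIdeal.isMaximal _).isPrime.mem_or_mem h3).resolve_left fun h4 => ?_
    exact s.2 ((IsLocalization.AtPrime.to_map_mem_maximal_iff _ P _).mp h4)
  · intro h c hc j
    have h1 := h (fun j => residue _ (algebraMap R _ (c j))) ((key _).mpr (by
      simpa using hc)) j
    rw [IsLocalRing.residue_eq_zero_iff] at h1
    exact (IsLocalization.AtPrime.to_map_mem_maximal_iff _ P _).mp h1

lemma exists_local_generators {R : Type*} [CommRing R] [IsNoetherianRing R] (P : Ideal R)
    [P.IsPrime] {m : ℕ} (y : Fin m → R) (hy : ∀ j, y j ∈ P) (hind : IndepAt P y) :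
    ∃ (k : ℕ) (z : Fin k → R), (∀ i, z i ∈ P) ∧
      m + k = Module.finrank P.ResidueField (CotangentSpace (Localization.AtPrime P)) ∧
      IndepAt P z ∧
      ∀ g ∈ P, ∃ s ∉ P, s * g ∈ Ideal.span (Set.range y ∪ Set.range z) := by
  classical
  let A := Localization.AtPrime P
  let θ : P → CotangentSpace A := fun g =>
    (maximalIdeal A).toCotangent ⟨algebraMap R A g, algebraMap_mem_maximalIdeal g.2⟩
  have hθspan : Submodule.span P.ResidueField (Set.range θ) = ⊤ := by
    have : Set.range θ = (maximalIdeal A).toCotangent ''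
        (Set.range fun g : P => (⟨algebraMap R A g, algebraMap_mem_maximalIdeal g.2⟩ :
          maximalIdeal A)) := by
      rw [← Set.range_comp]; rfl
    rw [this]
    refine CotangentSpace.span_image_eq_top_iff.mpr ?_
    rw [eq_top_iff]
    rintro ⟨a, ha⟩ -
    obtain ⟨⟨r, s⟩, rfl⟩ := IsLocalization.mk'_surjective P.primeCompl a
    have hr : r ∈ P := (IsLocalization.AtPrime.mk'_mem_maximal_iff A P r s).mp ha
    have : (⟨IsLocalization.mk' A r s, ha⟩ : maximalIdeal A) =
        IsLocalization.mk' A 1 s • ⟨algebraMap R A r, algebraMap_mem_maximalIdeal hr⟩ := by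
      ext
      exact (IsLocalization.mk'_eq_mul_mk'_one _ _).trans (mul_comm _ _)
    rw [this]
    exact Submodule.smul_mem _ _ (Submodule.subset_span ⟨⟨r, hr⟩, rfl⟩)
  let w : Fin m → CotangentSpace A := fun j => θ ⟨y j, hy j⟩
  have hw : LinearIndependent P.ResidueField w := (indepAt_iff P y hy).mp hind
  obtain ⟨b, hbθ, hwb, hθb, hb⟩ := exists_linearIndepOn_id_extension
    (s := Set.range w) (t := Set.range θ) hw.linearIndepOn_id (by
      rintro _ ⟨j, rfl⟩; exact ⟨_, rfl⟩)
  have hbtop : Submodule.span P.ResidueField b = ⊤ := by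
    rw [eq_top_iff, ← hθspan, Submodule.span_le]
    exact hθb
  have hbfin : b.Finite := LinearIndependent.setFinite hb
  have hbcard : b.ncard = Module.finrank P.ResidueField (CotangentSpace A) := by
    have := hbfin.fintype
    rw [← finrank_top, ← hbtop, finrank_span_set_eq_card hb, Set.ncard_eq_toFinset_card']
  let b' := b \ Set.range w
  have hb'fin : Finite b' := hbfin.subset Set.sdiff_subset
  have hcard : m + Nat.card b' = Module.finrank P.ResidueField (CotangentSpace A) := by
    have h1 : (Set.range w).ncard = m := by
      rw [← Set.image_univ, Set.ncard_image_of_injective _ hw.injective, Set.ncard_univ]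
      simp
    have := Set.ncard_sdiff_add_ncard_of_subset hwb hbfin
    rw [← hbcard, ← this, h1, Nat.card_coe_set_eq, add_comm]
  let e : Fin (Nat.card b') ≃ b' := (Finite.equivFin b').symm
  choose z hz using fun i => hbθ (e i).2.1
  refine ⟨Nat.card b', fun i => z i, fun i => (z i).2, hcard, ?_, ?_⟩
  · rw [indepAt_iff P _ fun i => (z i).2]
    have : (fun i => (maximalIdeal A).toCotangent
        ⟨algebraMap R A (z i), algebraMap_mem_maximalIdeal (z i).2⟩) =
        (fun x : b => (x : CotangentSpace A)) ∘ (fun i => ⟨(e i : CotangentSpace A), (e i).2.1⟩) := by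
      ext i
      exact hz i
    rw [this]
    refine LinearIndependent.comp hb _ fun i j hij => e.injective ?_
    simpa [Subtype.ext_iff] using hij
  · intro g hg
    let S : Set R := Set.range y ∪ Set.range fun i => (z i : R)
    have hS : S ⊆ P := by
      rintro _ (⟨j, rfl⟩ | ⟨i, rfl⟩)
      exacts [hy j, (z i).2]
    have htop : Submodule.span A (Set.range fun x : S =>
        (⟨algebraMap R A x, algebraMap_mem_maximalIdeal (hS x.2)⟩ : maximalIdeal A)) = ⊤ := by
      rw [← CotangentSpace.span_image_eq_top_iff, eq_top_iff, ← hbtop, Submodule.span_le]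
      intro v hv
      refine Submodule.subset_span ?_
      by_cases hvw : v ∈ Set.range w
      · obtain ⟨j, rfl⟩ := hvw
        exact ⟨_, ⟨⟨y j, Or.inl ⟨j, rfl⟩⟩, rfl⟩, rfl⟩
      · refine ⟨_, ⟨⟨z (e.symm ⟨v, hv, hvw⟩), Or.inr ⟨_, rfl⟩⟩, rfl⟩, ?_⟩
        exact (hz _).trans (congrArg Subtype.val (e.apply_symm_apply _))
    have hmem : algebraMap R A g ∈ (Ideal.span S).map (algebraMap R A) := by
      have h1 : (⟨algebraMap R A g, algebraMap_mem_maximalIdeal hg⟩ : maximalIdeal A) ∈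
        Submodule.span A (Set.range fun x : S =>
          (⟨algebraMap R A x, algebraMap_mem_maximalIdeal (hS x.2)⟩ : maximalIdeal A)) := by
        rw [htop]; trivial
      have h2 := Submodule.mem_map_of_mem (f := (maximalIdeal A).subtype) h1
      rw [Submodule.map_span, ← Set.range_comp] at h2
      rw [Ideal.map_span]
      refine Submodule.span_mono ?_ h2
      rintro _ ⟨x, rfl⟩
      exact ⟨x, x.2, rfl⟩
    obtain ⟨⟨a, s⟩, has⟩ := (IsLocalization.mem_map_algebraMap_iff P.primeCompl A).mp hmem
    rw [← map_mul, IsLocalization.eq_iff_exists P.primeCompl] at has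
    obtain ⟨t, ht⟩ := has
    refine ⟨t * s, fun h => (‹P.IsPrime›.mem_or_mem h).elim t.2 s.2, ?_⟩
    rw [show (t * s * g : R) = t * (g * s) by ring, ht]
    exact Ideal.mul_mem_left _ _ a.2

lemma MvPolynomial.pderiv_mem_of_algebraMap_mem_sq {K σ : Type*} [Field K]
    (P : Ideal (MvPolynomial σ K)) [P.IsPrime] {g : MvPolynomial σ K}
    (hg : algebraMap _ (Localization.AtPrime P) g ∈ maximalIdeal (Localization.AtPrime P) ^ 2)
    (u : σ) : pderiv u g ∈ P := by
  have hgP : g ∈ P := (IsLocalization.AtPrime.to_map_mem_maximal_iff _ P g).mp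
    (Ideal.pow_le_self two_ne_zero hg)
  rw [← Localization.AtPrime.map_eq_maximalIdeal, ← Ideal.map_pow,
    IsLocalization.mem_map_algebraMap_iff P.primeCompl] at hg
  obtain ⟨⟨a, s⟩, has⟩ := hg
  rw [← map_mul, IsLocalization.eq_iff_exists P.primeCompl] at has
  obtain ⟨t, ht⟩ := has
  have hsq (f) (hf : f ∈ P ^ 2) : pderiv u f ∈ P := by
    rw [pow_two] at hf
    induction hf using Submodule.mul_induction_on' with
    | mem_mul_mem p hp q hq =>
      rw [Derivation.leibniz]
      exact P.add_mem (P.mul_mem_right _ hp) (P.mul_mem_right _ hq)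
    | add p _ q _ hp hq =>
      rw [map_add]
      exact P.add_mem hp hq
  have h1 := hsq (t * (g * s)) (by rw [ht]; exact Ideal.mul_mem_left _ _ a.2)
  rw [show (t * (g * s) : MvPolynomial σ K) = (t * s) * g by ring, Derivation.leibniz] at h1
  have h2 := (P.add_mem_iff_left (P.mul_mem_right (pderiv u (t * s : MvPolynomial σ K)) hgP)).mp h1
  exact (‹P.IsPrime›.mem_or_mem h2).resolve_left
    fun h => (‹P.IsPrime›.mem_or_mem h).elim t.2 s.2

lemma height_comap_mk_span_range_le {R : Type*} [CommRing R] [IsNoetherianRing R] {m : ℕ}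
    (y : Fin m → R) (p : PrimeSpectrum (R ⧸ Ideal.span (Set.range y))) :
    (p.asIdeal.comap (Ideal.Quotient.mk (Ideal.span (Set.range y)))).height ≤
      p.asIdeal.height + m := by
  refine (Ideal.height_le_height_add_encard_of_subset (Set.range y) ?_).trans ?_
  · rintro _ ⟨j, rfl⟩
    change Ideal.Quotient.mk _ (y j) ∈ p.asIdeal
    rw [Ideal.Quotient.eq_zero_iff_mem.mpr (Ideal.subset_span (Set.mem_range_self j))]
    exact zero_mem _
  · rw [Ideal.map_comap_of_surjective _ Ideal.Quotient.mk_surjective]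
    gcongr
    rw [← Set.image_univ]
    exact (Set.encard_image_le _ _).trans (by simp)

lemma isRegularLocal_of_indepAt {R : Type*} [CommRing R] [IsNoetherianRing R] {m : ℕ}
    (y : Fin m → R) (p : PrimeSpectrum (R ⧸ Ideal.span (Set.range y)))
    (hreg : IsRegularLocalRing
      (Localization.AtPrime (p.asIdeal.comap (Ideal.Quotient.mk (Ideal.span (Set.range y))))))
    (hind : IndepAt (p.asIdeal.comap (Ideal.Quotient.mk (Ideal.span (Set.range y)))) y) :
    IsRegularLocal (Localization.AtPrime p.asIdeal) := by
  classical
  set P := p.asIdeal.comap (Ideal.Quotient.mk (Ideal.span (Set.range y))) with hP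
  have hle : Ideal.span (Set.range y) ≤ P := by
    intro a ha
    rw [hP, Ideal.mem_comap, Ideal.Quotient.eq_zero_iff_mem.mpr ha]
    exact zero_mem _
  have hyP : ∀ j, y j ∈ P := fun j => hle (Ideal.subset_span ⟨j, rfl⟩)
  have hmap : P.map (Ideal.Quotient.mk (Ideal.span (Set.range y))) = p.asIdeal :=
    Ideal.map_comap_of_surjective _ Ideal.Quotient.mk_surjective _
  obtain ⟨k, z, hzP, hk, -, hz⟩ := exists_local_generators P y hyP hind
  let B := Localization.AtPrime p.asIdeal
  let φ : R →+* B := (algebraMap _ B).comp (Ideal.Quotient.mk (Ideal.span (Set.range y)))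
  have hφ : P.map φ = maximalIdeal B := by
    rw [← Ideal.map_map, hmap, Localization.AtPrime.map_eq_maximalIdeal]
  let s : Finset B := Finset.univ.image (φ ∘ z)
  have hs : Ideal.span (s : Set B) = maximalIdeal B := by
    refine le_antisymm ?_ ?_
    · rw [Ideal.span_le, ← hφ]
      intro b hb
      simp only [s, Finset.coe_image, Finset.coe_univ, Set.image_univ, Set.mem_range] at hb
      obtain ⟨i, rfl⟩ := hb
      exact Ideal.mem_map_of_mem _ (hzP i)
    · rw [← hφ, Ideal.map_le_iff_le_comap]
      intro g hg
      obtain ⟨t, ht, htg⟩ := hz g hg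
      have h1 : φ (t * g) ∈ Ideal.span (s : Set B) := by
        have h2 : Ideal.span (Set.range y ∪ Set.range z) ≤ (Ideal.span (s : Set B)).comap φ := by
          rw [Ideal.span_le]
          rintro _ (⟨j, rfl⟩ | ⟨i, rfl⟩)
          · have : φ (y j) = 0 := by
              simp only [φ, RingHom.comp_apply]
              rw [Ideal.Quotient.eq_zero_iff_mem.mpr (Ideal.subset_span (Set.mem_range_self j)),
                map_zero]
            simp [this]
          · exact Ideal.subset_span (by simp [s])
        exact h2 htg
      rw [map_mul] at h1
      have hu : IsUnit (φ t) :=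
        (IsLocalization.AtPrime.isUnit_to_map_iff B p.asIdeal _).mpr ht
      exact (Ideal.unit_mul_mem_iff_mem _ hu).mp h1
  have hcard : s.card ≤ k := Finset.card_image_le.trans (by simp)
  have hPk : ((m + k : ℕ) : ℕ∞) = P.height := by
    have h1 := (IsRegularLocalRing.iff_finrank_cotangentSpace _).mp hreg
    rw [IsLocalization.AtPrime.ringKrullDim_eq_height P] at h1
    rw [hk]
    exact_mod_cast h1
  have h1 : P.height ≤ p.asIdeal.height + m := height_comap_mk_span_range_le y p
  have hkp : (k : ℕ∞) ≤ p.asIdeal.height := by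
    rw [← hPk, Nat.cast_add, add_comm] at h1
    exact (ENat.add_le_add_iff_right (ENat.natCast_ne_top m)).mp h1
  have hdim : ringKrullDim B = p.asIdeal.height :=
    IsLocalization.AtPrime.ringKrullDim_eq_height p.asIdeal B
  have hkrull : p.asIdeal.height ≤ s.card := by
    have h2 : (maximalIdeal B).height ≤ s.card :=
      Ideal.height_le_card_of_mem_minimalPrimes_span_finset (by
        rw [hs, Ideal.minimalPrimes_eq_subsingleton_self]
        rfl)
    have h3 := IsLocalRing.maximalIdeal_height_eq_ringKrullDim (R := B)
    rw [hdim] at h3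
    rwa [WithBot.coe_inj.mp h3] at h2
  refine ⟨inferInstance, inferInstance, s, ?_, ?_⟩
  · rw [hs]
    infer_instance
  · change _ = ringKrullDim B
    rw [hdim, le_antisymm hkrull (le_trans (by exact_mod_cast hcard) hkp)]
    rfl

lemma MvPolynomial.aeval_add_sub_aeval_mem {σ K A : Type*} [Fintype σ] [CommRing K] [CommRing A]
    [Algebra K A] (I : Ideal A) (a δ : σ → A) (hδ : ∀ u, δ u ∈ I) (g : MvPolynomial σ K) :
    aeval (a + δ) g - aeval a g ∈ I := by
  have h := Ideal.pow_le_self two_ne_zero (aeval_add_sub_mem I a δ hδ g)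
  exact (I.sub_mem_iff_left (Ideal.sum_mem _ fun u _ => Ideal.mul_mem_left _ _ (hδ u))).mp h

lemma IndepAt.exists_jacobian_dual {σ K : Type*} [Field K] [PerfectField K] [Fintype σ]
    (P : Ideal (MvPolynomial σ K)) [P.IsPrime] {h : ℕ} (f : Fin h → MvPolynomial σ K)
    (hf : ∀ k, f k ∈ P) (hind : IndepAt P f) :
    ∃ v : Fin h → σ → P.ResidueField, ∀ k i,
      ∑ u, algebraMap _ P.ResidueField (pderiv u (f k)) * v i u = if k = i then 1 else 0 := by
  classical
  let M : Matrix (Fin h) σ P.ResidueField :=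
    Matrix.of fun k u => algebraMap _ P.ResidueField (pderiv u (f k))
  have hM : LinearIndependent P.ResidueField M.row := by
    rw [Fintype.linearIndependent_iff]
    intro g hg j
    choose a ha using fun j => IsLocalRing.residue_surjective (g j)
    obtain ⟨s, hs⟩ := IsLocalization.exist_integer_multiples P.primeCompl Finset.univ a
    choose r hr using fun j => hs j (Finset.mem_univ j)
    have hrg (j) : algebraMap _ P.ResidueField (r j) = algebraMap _ P.ResidueField s.1 * g j := by
      rw [← ha j]
      have := congrArg (residue _) (hr j)
      rwa [Algebra.smul_def, map_mul] at this
    have hd (u) : ∑ k, r k * pderiv u (f k) ∈ P := by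
      rw [← Ideal.algebraMap_residueField_eq_zero, map_sum]
      have h1 := congrFun hg u
      simp only [Finset.sum_apply, Pi.smul_apply, smul_eq_mul, Pi.zero_apply] at h1
      simp only [map_mul, hrg, mul_assoc]
      rw [← Finset.mul_sum]
      exact mul_eq_zero_of_right _ h1
    have hmem : ∑ k, r k * f k ∈ P := Ideal.sum_mem _ fun k _ => P.mul_mem_left _ (hf k)
    have h2 := hind r (algebraMap_mem_maximalIdeal_sq P hmem fun u => by
      rw [map_sum]
      simp only [Derivation.leibniz, smul_eq_mul, Finset.sum_add_distrib]
      exact P.add_mem (hd u) (Ideal.sum_mem _ fun k _ => P.mul_mem_right _ (hf k))) j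
    rw [← Ideal.algebraMap_residueField_eq_zero, hrg] at h2
    exact (mul_eq_zero.mp h2).resolve_left fun h3 =>
      s.2 (Ideal.algebraMap_residueField_eq_zero.mp h3)
  have hsurj : Function.Surjective M.mulVec := by
    have h1 := LinearIndependent.rank_matrix hM
    rw [Matrix.rank] at h1
    have h2 : M.mulVecLin.range = ⊤ := Submodule.eq_top_of_finrank_eq (by simpa using h1)
    exact LinearMap.range_eq_top.mp h2
  choose v hv using fun i => hsurj (Pi.single i 1)
  refine ⟨v, fun k i => ?_⟩
  have := congrFun (hv i) k
  rw [Pi.single_apply] at this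
  exact this

namespace MvPolynomial

variable {σ K κ : Type*} [Field K] [Field κ] [Algebra K κ]

lemma aeval_C_comp (ξ : σ → κ) (g : MvPolynomial σ K) :
    aeval (fun u => (C (ξ u) : MvPolynomial σ κ)) g = C (aeval ξ g) := by
  induction g using MvPolynomial.induction_on with
  | C r => simp [MvPolynomial.algebraMap_apply]
  | add p q hp hq => simp [hp, hq]
  | mul_X p i hp => simp [hp]

lemma aeval_C_add_sub_mem [Fintype σ] (I : Ideal (MvPolynomial σ κ)) (ξ : σ → κ)
    (δ : σ → MvPolynomial σ κ) (hδ : ∀ u, δ u ∈ I) (g : MvPolynomial σ K) :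
    aeval (fun u => C (ξ u) + δ u) g - C (aeval ξ g) ∈ I := by
  rw [← aeval_C_comp]
  exact aeval_add_sub_aeval_mem I _ δ hδ g

lemma exists_approximate_solution [Fintype σ] {h : ℕ} (f : Fin h → MvPolynomial σ K) (ξ : σ → κ)
    (hf : ∀ k, aeval ξ (f k) = 0) (v : Fin h → σ → κ)
    (hv : ∀ k i, ∑ u, aeval ξ (pderiv u (f k)) * v i u = if k = i then 1 else 0) (n : ℕ) :
    ∃ ρ : Fin h → MvPolynomial σ κ, (∀ i, ρ i ∈ idealOfVars σ κ) ∧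
      ∀ k, aeval (fun u => C (ξ u) + (X u + ∑ i, C (v i u) * ρ i)) (f k) ∈
        idealOfVars σ κ ^ (n + 1) := by
  have hX (u : σ) : (X u : MvPolynomial σ κ) ∈ idealOfVars σ κ := Ideal.subset_span ⟨u, rfl⟩
  induction n with
  | zero =>
    refine ⟨0, fun i => zero_mem _, fun k => ?_⟩
    have := aeval_C_add_sub_mem (idealOfVars σ κ) ξ X hX (f k)
    simpa [hf] using this
  | succ n ih =>
    obtain ⟨ρ, hρ, hfρ⟩ := ih
    set z : σ → MvPolynomial σ κ := fun u => C (ξ u) + (X u + ∑ i, C (v i u) * ρ i) with hz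
    refine ⟨fun i => ρ i - aeval z (f i), fun i => Ideal.sub_mem _ (hρ i)
      (Ideal.pow_le_self (Nat.succ_ne_zero n) (hfρ i)), fun k => ?_⟩
    let δ : σ → MvPolynomial σ κ := fun u => -∑ i, C (v i u) * aeval z (f i)
    have hδ (u) : δ u ∈ idealOfVars σ κ ^ (n + 1) :=
      Ideal.neg_mem_iff _ |>.mpr (Ideal.sum_mem _ fun i _ => Ideal.mul_mem_left _ _ (hfρ i))
    have hzδ : (fun u => C (ξ u) + (X u + ∑ i, C (v i u) * (ρ i - aeval z (f i)))) = z + δ := by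
      ext1 u
      simp only [hz, δ, Pi.add_apply, mul_sub, Finset.sum_sub_distrib]
      ring
    rw [hzδ]
    have hT := aeval_add_sub_mem _ z δ hδ (f k)
    rw [← pow_mul] at hT
    have hT' := Ideal.pow_le_pow_right (show n + 1 + 1 ≤ (n + 1) * 2 by lia) hT
    have h1 : ∑ u, (aeval z (pderiv u (f k)) - C (aeval ξ (pderiv u (f k)))) * δ u ∈
        idealOfVars σ κ ^ (n + 1 + 1) := by
      refine Ideal.sum_mem _ fun u _ => ?_
      rw [pow_succ']
      refine Ideal.mul_mem_mul (aeval_C_add_sub_mem _ ξ _ (fun u => ?_) _) (hδ u)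
      exact Ideal.add_mem _ (hX u) (Ideal.sum_mem _ fun i _ => Ideal.mul_mem_left _ _ (hρ i))
    have h2 : ∑ u, C (aeval ξ (pderiv u (f k))) * δ u = - aeval z (f k) := by
      simp only [δ, mul_neg, Finset.sum_neg_distrib, Finset.mul_sum]
      rw [Finset.sum_comm]
      simp only [← mul_assoc, ← C_mul, ← Finset.sum_mul, ← map_sum, hv]
      simp
    convert Ideal.add_mem _ hT' h1 using 1
    simp only [sub_mul, Finset.sum_sub_distrib, h2]
    ring

lemma mem_pow_idealOfVars_of_mul_mem {c : κ} (hc : c ≠ 0) {a b : MvPolynomial σ κ}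
    (ha : a - C c ∈ idealOfVars σ κ) {n : ℕ} (hab : a * b ∈ idealOfVars σ κ ^ n) :
    b ∈ idealOfVars σ κ ^ n := by
  suffices ∀ k ≤ n, b ∈ idealOfVars σ κ ^ k from this n le_rfl
  intro k hk
  induction k with
  | zero => simp
  | succ k ih =>
    have h1 : (a - C c) * b ∈ idealOfVars σ κ ^ (k + 1) := by
      rw [pow_succ']
      exact Ideal.mul_mem_mul ha (ih (by lia))
    have h2 := Ideal.mul_mem_left _ (C c⁻¹)
      (Ideal.sub_mem _ (Ideal.pow_le_pow_right hk hab) h1)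
    convert h2 using 1
    rw [show a * b - (a - C c) * b = C c * b by ring, ← mul_assoc, ← C_mul, inv_mul_cancel₀ hc,
      C_1, one_mul]

end MvPolynomial

lemma MvPolynomial.exists_approximate_point {σ K : Type*} [Field K] [PerfectField K] [Fintype σ]
    (P : Ideal (MvPolynomial σ K)) [P.IsPrime] {h : ℕ} (f : Fin h → MvPolynomial σ K)
    (hf : ∀ k, f k ∈ P) (hind : IndepAt P f)
    (hgen : ∀ g ∈ P, ∃ s ∉ P, s * g ∈ Ideal.span (Set.range f)) (n : ℕ) :
    ∃ (v : Fin h → σ → P.ResidueField) (ρ : Fin h → MvPolynomial σ P.ResidueField),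
      (∀ i, ρ i ∈ idealOfVars σ P.ResidueField) ∧
      ∀ g ∈ P, aeval (fun u => C (algebraMap _ P.ResidueField (X u : MvPolynomial σ K)) +
        (X u + ∑ i, C (v i u) * ρ i)) g ∈ idealOfVars σ P.ResidueField ^ (n + 1) := by
  let ξ : σ → P.ResidueField := fun u => algebraMap _ P.ResidueField (X u : MvPolynomial σ K)
  have hξ (g : MvPolynomial σ K) : aeval ξ g = algebraMap _ P.ResidueField g := by
    have : aeval ξ = IsScalarTower.toAlgHom K (MvPolynomial σ K) P.ResidueField :=
      algHom_ext fun u => by simp [ξ]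
    rw [this]
    rfl
  obtain ⟨v, hv⟩ := hind.exists_jacobian_dual P f hf
  obtain ⟨ρ, hρ, hfρ⟩ := exists_approximate_solution f ξ
    (fun k => by rw [hξ]; exact Ideal.algebraMap_residueField_eq_zero.mpr (hf k)) v
    (fun k i => by simp only [hξ, hv]) n
  refine ⟨v, ρ, hρ, fun g hg => ?_⟩
  obtain ⟨s, hs, hsg⟩ := hgen g hg
  refine mem_pow_idealOfVars_of_mul_mem (c := aeval ξ s)
    (fun h0 => hs ?_) (aeval_C_add_sub_mem _ ξ
      (fun u => X u + ∑ i, C (v i u) * ρ i) (fun u => ?_) s) ?_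
  · rwa [hξ, Ideal.algebraMap_residueField_eq_zero] at h0
  · exact Ideal.add_mem _ (Ideal.subset_span ⟨u, rfl⟩)
      (Ideal.sum_mem _ fun i _ => Ideal.mul_mem_left _ _ (hρ i))
  · rw [← map_mul]
    have : Ideal.span (Set.range f) ≤ (idealOfVars σ P.ResidueField ^ (n + 1)).comap
        (aeval fun u => C (ξ u) + (X u + ∑ i, C (v i u) * ρ i)) := by
      rw [Ideal.span_le]
      rintro _ ⟨k, rfl⟩
      exact hfρ k
    exact this hsg

namespace MvPolynomial

lemma homogeneousComponent_mul_of_isHomogeneous {σ R : Type*} [CommRing R]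
    {s : MvPolynomial σ R} {n : ℕ} (hs : s.IsHomogeneous n) (b : MvPolynomial σ R) (a : ℕ) :
    homogeneousComponent (a + n) (b * s) = homogeneousComponent a b * s := by
  let _ := gradedAlgebra (σ := σ) (R := R)
  have h := DirectSum.coe_decompose_mul_add_of_right_mem (homogeneousSubmodule σ R)
    (i := a) (a := b) hs
  simpa only [DirectSum.decompose, Equiv.coe_fn_mk, decomposition.decompose'_apply] using h

lemma homogeneousComponent_eq_zero_of_mem_pow {σ R : Type*} [CommRing R] {p : MvPolynomial σ R}
    {n k : ℕ} (hp : p ∈ idealOfVars σ R ^ n) (hk : k < n) : homogeneousComponent k p = 0 := by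
  rw [mem_pow_idealOfVars_iff'] at hp
  ext x
  rw [coeff_homogeneousComponent]
  split_ifs with h
  · exact hp x (by lia)
  · rfl

lemma sub_sum_homogeneousComponent_mem {σ R : Type*} [CommRing R] {p : MvPolynomial σ R}
    (hp : p ∈ idealOfVars σ R) (n : ℕ) :
    p - ∑ t : Fin n, homogeneousComponent ((t : ℕ) + 1) p ∈ idealOfVars σ R ^ (n + 1) := by
  rw [← pow_one (idealOfVars σ R), mem_pow_idealOfVars_iff'] at hp
  rw [mem_pow_idealOfVars_iff']
  intro x hx
  rw [coeff_sub, coeff_sum]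
  simp only [coeff_homogeneousComponent]
  rcases Nat.eq_zero_or_pos x.degree with h0 | h0
  · rw [hp x (by lia), Finset.sum_eq_zero, sub_zero]
    intro t _
    rw [if_neg (by lia)]
  · rw [Finset.sum_eq_single ⟨x.degree - 1, by lia⟩]
    · rw [if_pos (by simp; lia), sub_self]
    · intro t _ ht
      rw [if_neg]
      intro h
      exact ht (Fin.ext (by simp; lia))
    · simp

lemma homogeneousComponent_translate_sub {σ R : Type*} [CommRing R] (ξ : σ → R)
    {F : MvPolynomial σ R} {n : ℕ} (hF : F.totalDegree ≤ n) :
    homogeneousComponent n (aeval (fun u => C (ξ u) + X u) F) = homogeneousComponent n F := by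
  classical
  have key (s : σ →₀ ℕ) : ∀ k, s.degree ≤ k → homogeneousComponent k
      (aeval (fun u => C (ξ u) + X u : σ → MvPolynomial σ R) (monomial s (1 : R)) -
        monomial s 1) = 0 := by
    obtain ⟨M, rfl⟩ := Multiset.toFinsupp.surjective s
    induction M using Multiset.induction_on with
    | empty => simp
    | cons i M ih =>
      rw [← Multiset.singleton_add, map_add, Multiset.toFinsupp_singleton, add_comm]
      intro k hk
      rw [map_add, Finsupp.degree_single] at hk
      obtain ⟨k, rfl⟩ : ∃ l, k = l + 1 := ⟨k - 1, by lia⟩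
      have h1 : (monomial (Multiset.toFinsupp M + Finsupp.single i 1) (1 : R)) =
          monomial (Multiset.toFinsupp M) 1 * X i := by
        rw [X, monomial_mul, one_mul]
      have h2 : homogeneousComponent (k + 1) (monomial (Multiset.toFinsupp M) (1 : R)) = 0 := by
        rw [homogeneousComponent_of_mem (isHomogeneous_monomial (n := M.toFinsupp.degree) _ rfl),
          if_neg (by lia)]
      rw [h1, map_mul, aeval_X]
      set p := aeval (fun u => C (ξ u) + X u : σ → MvPolynomial σ R)
        (monomial (Multiset.toFinsupp M) (1 : R))
      rw [show p * (C (ξ i) + X i) - monomial (Multiset.toFinsupp M) 1 * X i =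
        (p - monomial (Multiset.toFinsupp M) 1) * X i +
        C (ξ i) * (p - monomial (Multiset.toFinsupp M) 1) +
        C (ξ i) * monomial (Multiset.toFinsupp M) 1 by ring, map_add, map_add,
        homogeneousComponent_mul_of_isHomogeneous (isHomogeneous_X R i), ih k (by lia),
        homogeneousComponent_C_mul, homogeneousComponent_C_mul, ih (k + 1) (by lia), h2]
      simp
  rw [← sub_eq_zero, ← map_sub]
  conv_lhs => rw [F.as_sum]
  rw [map_sum, ← Finset.sum_sub_distrib, map_sum]
  refine Finset.sum_eq_zero fun s hs => ?_
  have h1 : monomial s (coeff s F) = C (coeff s F) * monomial s (1 : R) := by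
    rw [C_mul_monomial, mul_one]
  rw [h1, map_mul, ← algebraMap_eq, AlgHom.commutes, ← mul_sub, algebraMap_eq,
    homogeneousComponent_C_mul, key s n, mul_zero]
  exact (le_totalDegree hs).trans hF

lemma exists_collapse_homogeneousComponent {σ κ : Type*} [Fintype σ] [Field κ] {h E : ℕ}
    (F : MvPolynomial σ κ) (ξ : σ → κ) (v : Fin h → σ → κ) (ρ : Fin h → MvPolynomial σ κ)
    (hρ : ∀ i, ρ i ∈ idealOfVars σ κ) (htot : F.totalDegree ≤ E + 1)
    (hd : ∀ u, aeval ξ (pderiv u F) = 0)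
    (hF : aeval (fun u => C (ξ u) + (X u + ∑ i, C (v i u) * ρ i)) F ∈
      idealOfVars σ κ ^ (E + 2)) :
    ∃ g : Fin h × Fin E → MvPolynomial σ κ,
      (∀ p, (g p).IsHomogeneous (E - p.2)) ∧
      homogeneousComponent (E + 1) F =
        ∑ p, homogeneousComponent ((p.2 : ℕ) + 1) (ρ p.1) * g p := by
  let s : Fin h × Fin E → MvPolynomial σ κ := fun p => homogeneousComponent ((p.2 : ℕ) + 1) (ρ p.1)
  have hs (p) : (s p).IsHomogeneous (p.2 + 1) := homogeneousComponent_isHomogeneous _ _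
  have hX (u : σ) : (X u : MvPolynomial σ κ) ∈ idealOfVars σ κ := Ideal.subset_span ⟨u, rfl⟩
  have hsm (p) : s p ∈ idealOfVars σ κ := by
    rw [← pow_one (idealOfVars σ κ), mem_pow_idealOfVars_iff']
    intro x hx
    rw [coeff_homogeneousComponent, if_neg (by lia)]
  let a : σ → MvPolynomial σ κ := fun u => ∑ i, C (v i u) * ∑ t, s (i, t)
  let r : σ → MvPolynomial σ κ := fun u => ∑ i, C (v i u) * (ρ i - ∑ t, s (i, t))
  let w : σ → MvPolynomial σ κ := fun u => C (ξ u) + (X u + a u)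
  have hzw : (fun u => C (ξ u) + (X u + ∑ i, C (v i u) * ρ i)) = w + r := by
    ext1 u
    simp only [w, r, a, Pi.add_apply, mul_sub, Finset.sum_sub_distrib]
    ring
  have hr (u) : r u ∈ idealOfVars σ κ ^ (E + 1) :=
    Ideal.sum_mem _ fun i _ => Ideal.mul_mem_left _ _ (sub_sum_homogeneousComponent_mem (hρ i) E)
  have hw : aeval w F ∈ idealOfVars σ κ ^ (E + 2) := by
    have hT := aeval_add_sub_mem _ w r hr F
    rw [← pow_mul] at hT
    have hT' := Ideal.pow_le_pow_right (show E + 2 ≤ (E + 1) * 2 by lia) hT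
    rw [← hzw] at hT'
    have h1 : ∑ u, aeval w (pderiv u F) * r u ∈ idealOfVars σ κ ^ (E + 2) := by
      refine Ideal.sum_mem _ fun u _ => ?_
      rw [pow_succ' _ (E + 1)]
      refine Ideal.mul_mem_mul ?_ (hr u)
      have := aeval_C_add_sub_mem (idealOfVars σ κ) ξ (fun u => X u + a u) (fun u =>
        Ideal.add_mem _ (hX u) (Ideal.sum_mem _ fun i _ => Ideal.mul_mem_left _ _
          (Ideal.sum_mem _ fun t _ => hsm _))) (pderiv u F)
      rwa [hd, map_zero, sub_zero] at this
    have := Ideal.sub_mem _ hF (Ideal.add_mem _ hT' h1)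
    convert this using 1
    ring
  have hq : aeval w F - aeval (fun u => C (ξ u) + X u) F ∈ Ideal.span (Set.range s) := by
    have hwa : w = (fun u => C (ξ u) + X u) + a := by
      ext1 u
      simp only [w, Pi.add_apply]
      ring
    rw [hwa]
    exact aeval_add_sub_aeval_mem _ _ _ (fun u => Ideal.sum_mem _ fun i _ =>
      Ideal.mul_mem_left _ _ (Ideal.sum_mem _ fun t _ => Ideal.subset_span (Set.mem_range_self _))) F
  obtain ⟨b, hb⟩ := (Ideal.mem_span_range_iff_exists_fun).mp hq
  refine ⟨fun p => -homogeneousComponent (E - p.2) (b p), fun p =>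
    (homogeneousComponent_isHomogeneous _ _).neg, ?_⟩
  rw [← homogeneousComponent_translate_sub ξ htot, show aeval (fun u => C (ξ u) + X u) F =
    aeval w F - ∑ i, b i * s i by rw [hb]; ring, map_sub,
    homogeneousComponent_eq_zero_of_mem_pow hw (by lia), map_sum, zero_sub,
    ← Finset.sum_neg_distrib]
  refine Finset.sum_congr rfl fun p _ => ?_
  have h1 : E + 1 = (E - p.2) + (p.2 + 1) := by have := p.2.2; lia
  rw [show homogeneousComponent (E + 1) (b p * s p) =
    homogeneousComponent ((E - p.2) + (p.2 + 1)) (b p * s p) by rw [← h1],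
    homogeneousComponent_mul_of_isHomogeneous (hs p)]
  simp only [s]
  ring

end MvPolynomial

lemma nonempty_algHom_of_finiteType (K A : Type*) [Field K] [IsAlgClosed K] [CommRing A]
    [Nontrivial A] [Algebra K A] [Algebra.FiniteType K A] : Nonempty (A →ₐ[K] K) := by
  obtain ⟨M, hM⟩ := Ideal.exists_maximal A
  let _ : Field (A ⧸ M) := Ideal.Quotient.field M
  have : Module.Finite K (A ⧸ M) := finite_of_finite_type_of_isJacobsonRing K (A ⧸ M)
  let φ : (A ⧸ M) →ₐ[K] K := IsAlgClosed.lift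
  exact ⟨φ.comp (Ideal.Quotient.mkₐ K M)⟩

lemma exists_subalgebra_algHom {K κ : Type*} [Field K] [IsAlgClosed K] [Field κ] [Algebra K κ]
    (T : Finset κ) : ∃ (A : Subalgebra K κ) (_ : A →ₐ[K] K), (T : Set κ) ⊆ A := by
  have : Algebra.FiniteType K (Algebra.adjoin K (T : Set κ)) :=
    (Subalgebra.fg_iff_finiteType _).mp ⟨T, rfl⟩
  obtain ⟨φ⟩ := nonempty_algHom_of_finiteType K (Algebra.adjoin K (T : Set κ))
  exact ⟨_, φ, Algebra.subset_adjoin⟩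

lemma exists_specialization {σ K κ ι τ : Type*} [Fintype ι] [Fintype τ] [Field K] [IsAlgClosed K]
    [Field κ] [Algebra K κ] (Y : ι → MvPolynomial σ K) (a : ι → κ) (i₀ : ι) (ha : a i₀ ≠ 0)
    (f g : τ → MvPolynomial σ κ) (df dg : τ → ℕ) (hf : ∀ t, (f t).IsHomogeneous (df t))
    (hg : ∀ t, (g t).IsHomogeneous (dg t))
    (hYfg : ∑ i, C (a i) * map (algebraMap K κ) (Y i) = ∑ t, f t * g t) :
    ∃ (b : ι → K) (f' g' : τ → MvPolynomial σ K), b i₀ ≠ 0 ∧ (∀ i, a i = 0 → b i = 0) ∧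
      (∀ t, (f' t).IsHomogeneous (df t)) ∧ (∀ t, (g' t).IsHomogeneous (dg t)) ∧
      ∑ i, C (b i) * Y i = ∑ t, f' t * g' t := by
  classical
  obtain ⟨A, φ, hA⟩ := exists_subalgebra_algHom (K := K)
    (insert (a i₀)⁻¹ (Finset.univ.image a ∪ Finset.univ.biUnion (fun t => (f t).coeffs) ∪
      Finset.univ.biUnion (fun t => (g t).coeffs)))
  have haA (i) : a i ∈ A := hA (by simp)
  have hinv : (a i₀)⁻¹ ∈ A := hA (by simp)
  let ι' : A →+* κ := A.val
  have hι : Function.Injective ι' := Subtype.val_injective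
  have hfA (t) : f t ∈ (map ι' : MvPolynomial σ A →+* _).range := by
    refine mem_range_map_iff_coeffs_subset.mpr fun x hx => ⟨⟨x, hA ?_⟩, rfl⟩
    simp only [Finset.coe_insert, Finset.coe_union, Finset.coe_biUnion]
    exact Or.inr (Or.inl (Or.inr (by simpa using ⟨t, hx⟩)))
  have hgA (t) : g t ∈ (map ι' : MvPolynomial σ A →+* _).range := by
    refine mem_range_map_iff_coeffs_subset.mpr fun x hx => ⟨⟨x, hA ?_⟩, rfl⟩
    simp only [Finset.coe_insert, Finset.coe_union, Finset.coe_biUnion]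
    exact Or.inr (Or.inr (by simpa using ⟨t, hx⟩))
  choose f₁ hf₁ using hfA
  choose g₁ hg₁ using hgA
  have hid : ∑ i, C (⟨a i, haA i⟩ : A) * map (algebraMap K A) (Y i) = ∑ t, f₁ t * g₁ t := by
    apply map_injective ι' hι
    simp only [map_sum, map_mul, hf₁, hg₁, ← hYfg, map_C, map_map]
    rfl
  refine ⟨fun i => φ ⟨a i, haA i⟩, fun t => map (φ : A →+* K) (f₁ t),
    fun t => map (φ : A →+* K) (g₁ t), fun h0 => ?_, fun i hi => ?_, fun t => ?_, fun t => ?_, ?_⟩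
  · have h1 : (⟨a i₀, haA i₀⟩ * ⟨(a i₀)⁻¹, hinv⟩ : A) = 1 := Subtype.ext (mul_inv_cancel₀ ha)
    have h2 := congrArg φ h1
    rw [map_mul, show φ ⟨a i₀, haA i₀⟩ = 0 from h0, zero_mul, map_one] at h2
    exact zero_ne_one h2
  · have : (⟨a i, haA i⟩ : A) = 0 := Subtype.ext hi
    simp only [this, map_zero]
  · exact (IsHomogeneous.of_map hι (f := ι') (by rw [hf₁]; exact hf t)).map _
  · exact (IsHomogeneous.of_map hι (f := ι') (by rw [hg₁]; exact hg t)).map _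
  · have := congrArg (map (φ : A →+* K)) hid
    simp only [map_sum, map_mul, map_C, map_map] at this
    rw [← this]
    refine Finset.sum_congr rfl fun i _ => ?_
    have hφ : (φ : A →+* K).comp (algebraMap K A) = RingHom.id K := by
      ext x
      simp
    rw [hφ, map_id]
    rfl

lemma HasCollapse.of_fintype {K τ : Type*} [CommSemiring K] [Fintype τ] {N k : ℕ}
    {F : MvPolynomial (Fin N) K} (hk : Fintype.card τ ≤ k) (f g : τ → MvPolynomial (Fin N) K)
    (hf : ∀ t, ∃ d > 0, (f t).IsHomogeneous d) (hg : ∀ t, ∃ d > 0, (g t).IsHomogeneous d)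
    (hF : F = ∑ t, f t * g t) : HasCollapse k F := by
  let e := Fintype.equivFin τ
  let ext (f : τ → MvPolynomial (Fin N) K) (i : Fin k) : MvPolynomial (Fin N) K :=
    if h : (i : ℕ) < Fintype.card τ then f (e.symm ⟨i, h⟩) else 0
  have hext (f : τ → MvPolynomial (Fin N) K) (hf : ∀ t, ∃ d > 0, (f t).IsHomogeneous d) (i) :
      ∃ d > 0, (ext f i).IsHomogeneous d := by
    simp only [ext]
    split_ifs
    · exact hf _
    · exact ⟨1, one_pos, isHomogeneous_zero _ _ _⟩
  refine ⟨ext f, ext g, hext f hf, hext g hg, ?_⟩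
  rw [hF]
  let j : τ → Fin k := fun t => Fin.castLE hk (e t)
  have hj : Function.Injective j := (Fin.castLE_injective hk).comp e.injective
  refine Fintype.sum_of_injective j hj _ _ (fun i hi => ?_) fun t => ?_
  · simp only [ext]
    rw [dif_neg, zero_mul]
    intro h
    exact hi ⟨e.symm ⟨i, h⟩, by simp [j]⟩
  · simp [ext, j]

lemma exists_collapse_of_jacobian_relation {K : Type*} [Field K] [IsAlgClosed K] {N h m : ℕ}
    (P : Ideal (MvPolynomial (Fin N) K)) [P.IsPrime] (f : Fin h → MvPolynomial (Fin N) K)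
    (hf : ∀ k, f k ∈ P) (hind : IndepAt P f)
    (hgen : ∀ g ∈ P, ∃ s ∉ P, s * g ∈ Ideal.span (Set.range f))
    (y : Fin m → MvPolynomial (Fin N) K) (D : Fin m → ℕ)
    (hD : ∀ j, (y j).IsHomogeneous (D j + 1)) (hy : ∀ j, y j ∈ P)
    (c : Fin m → MvPolynomial (Fin N) K) (hc : ∀ u, ∑ j, c j * pderiv u (y j) ∈ P)
    (hcP : ∃ j, c j ∉ P) :
    ∃ (b : Fin m → K) (j₁ : Fin m), b j₁ ≠ 0 ∧ (∀ j, b j ≠ 0 → D j = D j₁) ∧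
      HasCollapse (h * D j₁) (∑ j, C (b j) * y j) := by
  classical
  obtain ⟨j₁, hj₁, hmax⟩ := (Finset.univ.filter fun j => c j ∉ P).exists_max_image D (by
    obtain ⟨j, hj⟩ := hcP
    exact ⟨j, by simpa using hj⟩)
  simp only [Finset.mem_filter, Finset.mem_univ, true_and] at hj₁ hmax
  set E := D j₁ with hE
  let γ : Fin m → P.ResidueField := fun j => algebraMap _ P.ResidueField (c j)
  have hγ (j) : γ j = 0 ↔ c j ∈ P := Ideal.algebraMap_residueField_eq_zero
  let Y : Fin m → MvPolynomial (Fin N) P.ResidueField := fun j => map (algebraMap K _) (y j)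
  have hY (j) : (Y j).IsHomogeneous (D j + 1) := (hD j).map _
  let F : MvPolynomial (Fin N) P.ResidueField := ∑ j, C (γ j) * Y j
  obtain ⟨v, ρ, hρ, hap⟩ := exists_approximate_point P f hf hind hgen (E + 1)
  have htot : F.totalDegree ≤ E + 1 := by
    refine totalDegree_finsetSum_le fun j _ => ?_
    by_cases h0 : c j ∈ P
    · simp [(hγ j).mpr h0]
    · rw [← smul_eq_C_mul]
      refine (totalDegree_smul_le _ _).trans ((hY j).totalDegree_le.trans ?_)
      exact Nat.succ_le_succ (hmax j h0)
  have hcoe (g : MvPolynomial (Fin N) K) :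
      aeval (fun u => algebraMap _ P.ResidueField (X u : MvPolynomial (Fin N) K)) g =
        algebraMap _ P.ResidueField g := by
    have : aeval (fun u => algebraMap _ P.ResidueField (X u : MvPolynomial (Fin N) K)) =
        IsScalarTower.toAlgHom K (MvPolynomial (Fin N) K) P.ResidueField :=
      algHom_ext fun u => by simp
    rw [this]
    rfl
  obtain ⟨g, hg, hcomp⟩ := exists_collapse_homogeneousComponent (E := E) F
    (fun u => algebraMap _ P.ResidueField (X u : MvPolynomial (Fin N) K)) v ρ hρ htot
    (fun u => by
      simp only [F, Y, map_sum, pderiv_C_mul, pderiv_map, map_mul, aeval_C,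
        Algebra.algebraMap_self, RingHom.id_apply, aeval_map_algebraMap, hcoe, γ]
      simp only [← map_mul, ← map_sum]
      exact Ideal.algebraMap_residueField_eq_zero.mpr (hc u))
    (by
      simp only [F, Y, map_sum, map_mul, aeval_map_algebraMap]
      exact Ideal.sum_mem _ fun j _ => Ideal.mul_mem_left _ _ (hap _ (hy j)))
  have hFE : homogeneousComponent (E + 1) F =
      ∑ j, C (if D j = E then γ j else 0) * Y j := by
    rw [map_sum]
    refine Finset.sum_congr rfl fun j _ => ?_
    rw [homogeneousComponent_C_mul, homogeneousComponent_of_mem (hY j)]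
    by_cases h : D j = E
    · simp [h]
    · simp [h, Ne.symm h]
  rw [hFE] at hcomp
  obtain ⟨b, f', g', hb, hb0, hf', hg', hbfg⟩ := exists_specialization y
    (fun j => if D j = E then γ j else 0) j₁ (by simpa [← hE] using (hγ j₁).not.mpr hj₁) _ _
    (fun p : Fin h × Fin E => (p.2 : ℕ) + 1) (fun p => E - p.2)
    (fun p => homogeneousComponent_isHomogeneous _ _) hg hcomp
  refine ⟨b, j₁, hb, fun j hj => ?_, ?_⟩
  · by_contra h
    exact hj (hb0 j (if_neg h))
  · exact HasCollapse.of_fintype (τ := Fin h × Fin E) (by simp [hE]) f' g'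
      (fun p => ⟨_, Nat.succ_pos _, hf' p⟩)
      (fun p => ⟨_, Nat.sub_pos_of_lt p.2.2, hg' p⟩) hbfg

lemma HasCollapse.mono {K : Type*} [CommSemiring K] {N k l : ℕ} {F : MvPolynomial (Fin N) K}
    (h : HasCollapse k F) (hkl : k ≤ l) : HasCollapse l F := by
  obtain ⟨f, g, hf, hg, hF⟩ := h
  exact HasCollapse.of_fintype (by simpa using hkl) f g hf hg hF

lemma mul_le_knuth {a : ℕ} (ha : 2 ≤ a) (k b : ℕ) (hb : 1 ≤ b) : a * b ≤ knuth a (k + 1) b := by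
  induction k generalizing b with
  | zero =>
    rw [zero_add, knuth]
    induction b, hb using Nat.le_induction with
    | base => simp
    | succ b hb ih =>
      rw [pow_succ]
      have h1 : b + 1 ≤ b * a := by nlinarith
      calc a * (b + 1) ≤ a * (b * a) := Nat.mul_le_mul_left _ h1
        _ = a * b * a := (mul_assoc _ _ _).symm
        _ ≤ _ := Nat.mul_le_mul_right _ ih
  | succ k ih =>
    induction b, hb using Nat.le_induction with
    | base => simp [knuth]
    | succ b hb ihb =>
      obtain ⟨b, rfl⟩ := Nat.exists_eq_add_of_le' hb
      rw [knuth]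
      have h1 : 1 ≤ knuth a (k + 2) (b + 1) := by nlinarith
      have h2 := ih _ h1
      nlinarith

lemma mul_le_strength_bound {η d S h e : ℕ} (hd : 2 ≤ d) (hh : h ≤ η + S) (he : e < d) :
    h * e ≤ if d = 2 then η + 4 * S + 1
      else S - 1 + knuth d (d ^ 2 - d - 1) (3 ^ (η + 3 * S)) := by
  split_ifs with hd2
  · have : h * e ≤ h * 1 := Nat.mul_le_mul_left _ (by lia)
    lia
  · have hk : d ^ 2 - d - 1 = (d ^ 2 - d - 2) + 1 := by
      have : 3 * d ≤ d ^ 2 := by nlinarith [show 3 ≤ d by lia]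
      lia
    rw [hk]
    have h1 := mul_le_knuth hd (d ^ 2 - d - 2) (3 ^ (η + 3 * S)) (Nat.one_le_pow _ _ (by norm_num))
    have h2 : η + 3 * S < 3 ^ (η + 3 * S) := Nat.lt_pow_self (by norm_num)
    calc h * e ≤ 3 ^ (η + 3 * S) * d := Nat.mul_le_mul (by lia) he.le
      _ = d * 3 ^ (η + 3 * S) := mul_comm _ _
      _ ≤ _ := h1
      _ ≤ _ := Nat.le_add_left _ _

lemma card_le_sum_finrank {K M ι : Type*} [Field K] [AddCommGroup M] [Module K M] [Fintype ι]
    {n : ℕ} (y : Fin n → M) (hli : LinearIndependent K y) (V : ι → Submodule K M)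
    (hV : ∀ j, V j ≤ Submodule.span K (Set.range y)) (hyV : ∀ i, ∃ j, y i ∈ V j) :
    n ≤ ∑ j, Module.finrank K (V j) := by
  classical
  choose J hJ using hyV
  have hfin : FiniteDimensional K (Submodule.span K (Set.range y)) :=
    FiniteDimensional.span_of_finite K (Set.finite_range y)
  calc n = ∑ j, (Finset.univ.filter fun i => J i = j).card := by
        simpa using Finset.card_eq_sum_card_fiberwise (f := J) (s := Finset.univ)
          (t := Finset.univ) (fun _ _ => Finset.mem_univ _)
    _ ≤ _ := Finset.sum_le_sum fun j _ => by
        have : FiniteDimensional K (V j) := Submodule.finiteDimensional_of_le (hV j)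
        have hl : LinearIndependent K fun i : {i // J i = j} =>
            (⟨y i.1, by simpa only [i.2] using hJ i.1⟩ : V j) :=
          LinearIndependent.of_comp (V j).subtype (hli.comp _ Subtype.val_injective)
        rw [← Fintype.card_subtype]
        exact hl.fintype_card_le_finrank

/-- With `Ā_2(η,δ) = η + 4|δ| + 1` and `Ā_d(η,δ) = |δ| - 1 + d ↑^(d²-d-1) (3^(η+3|δ|))`
for `d ≥ 3`: if every nonzero element of every graded piece `V_j` of a graded vector
space `V` with dimension vector `δ` has strength at least `Ā_d(η,δ)`, then every
homogeneous `K`-basis of `V` is an `R_η`-sequence. -/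
theorem strength_implies_basis_serre_seq {K : Type*} [Field K] [IsAlgClosed K]
    (η : ℕ) (hη : 1 ≤ η) (d : ℕ) (hd : 2 ≤ d) (δ : Fin d → ℕ) {N : ℕ}
    (V : Fin d → Submodule K (MvPolynomial (Fin N) K))
    (hVhom : ∀ i : Fin d, ∀ f ∈ V i, f.IsHomogeneous ((i : ℕ) + 1))
    (hVdim : ∀ i : Fin d, Module.finrank K (V i) = δ i)
    (A : ℕ)
    (hA : A = if d = 2 then η + 4 * (∑ i, δ i) + 1
      else (∑ i, δ i) - 1 + knuth d (d ^ 2 - d - 1) (3 ^ (η + 3 * ∑ i, δ i)))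
    (hstr : ∀ j : Fin d, ∀ G ∈ V j, G ≠ 0 → ¬ HasCollapse A G)
    (n : ℕ) (y : Fin n → MvPolynomial (Fin N) K)
    (hyV : ∀ i : Fin n, ∃ j : Fin d, y i ∈ V j)
    (hli : LinearIndependent K y)
    (hspan : Submodule.span K (Set.range y) = ⨆ j : Fin d, V j) :
    IsSerreSeq η y := by
  have hn : n ≤ ∑ i, δ i := by
    simp only [← hVdim]
    exact card_le_sum_finrank y hli V (fun j => hspan ▸ le_iSup V j) hyV
  choose J hJ using hyV
  refine ⟨fun htop => ?_, fun m hm => ?_⟩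
  · have hle : Ideal.span (Set.range y) ≤ RingHom.ker (constantCoeff (R := K) (σ := Fin N)) := by
      rw [Ideal.span_le]
      rintro _ ⟨i, rfl⟩
      exact (hVhom _ _ (hJ i)).coeff_eq_zero (by simp)
    have h1 := hle (htop ▸ Submodule.mem_top (x := (1 : MvPolynomial (Fin N) K)))
    simp [RingHom.mem_ker] at h1
  have hset : y '' {j : Fin n | (j : ℕ) < m} = Set.range (y ∘ Fin.castLE hm) := by
    rw [Set.range_comp]
    congr 1
    ext j
    exact ⟨fun h => ⟨⟨j, h⟩, rfl⟩, by rintro ⟨i, rfl⟩; exact i.2⟩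
  rw [hset]
  set y' := y ∘ Fin.castLE hm
  intro p hp
  set P := p.asIdeal.comap (Ideal.Quotient.mk (Ideal.span (Set.range y'))) with hP
  have hreg : IsRegularLocalRing (Localization.AtPrime P) := inferInstance
  have hyP (j) : y' j ∈ P := by
    rw [hP, Ideal.mem_comap,
      Ideal.Quotient.eq_zero_iff_mem.mpr (Ideal.subset_span (Set.mem_range_self j))]
    exact zero_mem _
  refine isRegularLocal_of_indepAt y' p hreg fun c hc => ?_
  by_contra! hcP
  obtain ⟨h, f, hfP, hh, hind, hgen⟩ := exists_local_generators P (Fin.elim0 : Fin 0 → _)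
    (fun j => j.elim0) (fun _ _ j => j.elim0)
  have hhη : h ≤ η + ∑ i, δ i := by
    have h1 := (IsRegularLocalRing.iff_finrank_cotangentSpace _).mp hreg
    rw [IsLocalization.AtPrime.ringKrullDim_eq_height P] at h1
    have h2 : (h : ℕ∞) = P.height := by
      rw [← zero_add h, hh]
      exact_mod_cast h1
    have h3 := height_comap_mk_span_range_le y' p
    rw [PrimeSpectrum.height_eq_orderHeight, ← hP, ← h2] at h3
    have h4 : (h : ℕ∞) ≤ ((η + m : ℕ) : ℕ∞) := h3.trans (by push_cast; gcongr)
    have h5 : h ≤ η + m := by exact_mod_cast h4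
    lia
  obtain ⟨b, j₁, hb, hbD, hcol⟩ := exists_collapse_of_jacobian_relation P f hfP hind
    (by simpa using hgen) y' (fun j => J (Fin.castLE hm j)) (fun j => hVhom _ _ (hJ _)) hyP c
    (fun u => by
      have h1 := pderiv_mem_of_algebraMap_mem_sq P hc u
      simp only [map_sum, Derivation.leibniz, smul_eq_mul, Finset.sum_add_distrib] at h1
      exact (P.add_mem_iff_left (Ideal.sum_mem _ fun j _ => P.mul_mem_right _ (hyP j))).mp h1)
    hcP
  refine hstr (J (Fin.castLE hm j₁)) (∑ j, C (b j) * y' j) ?_ ?_ (hcol.mono ?_)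
  · refine Submodule.sum_mem _ fun j _ => ?_
    rw [← smul_eq_C_mul]
    by_cases h0 : b j = 0
    · simp [h0]
    · rw [← Fin.ext (hbD j h0)]
      exact Submodule.smul_mem _ _ (hJ _)
  · intro h0
    simp only [← smul_eq_C_mul] at h0
    exact hb (Fintype.linearIndependent_iff.mp
      (hli.comp _ (Fin.castLE_injective hm)) b h0 j₁)
  · rw [hA]
    exact mul_le_strength_bound hd hhη (J (Fin.castLE hm j₁)).2
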